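/- arXiv:2202.06713 — 8 statements merged into one kernel-verified Lean document; each statement's English description precedes it below -/
import Mathlib

section
/- Let F be a subfield of ℂ, let f ∈ F[t] be irreducible with f(ζ) = 0 for some ζ ∈ ℂ, and let p be a prime such that f(t^p) is reducible over F. Then there exists η in the field F(ζ) (the subfield of ℂ generated by F and ζ) such that η^p = ζ. Moreover, if f is monic with algebraic-integer coefficients, then η is an algebraic integer. -/
open Polynomial

/-- If `f` is irreducible with root `ζ` and `ζ` has no `p`-th root in `F(ζ)`, then `f(t^p)` is
irreducible. -/
theorem irreducible_expand_of_forall_pow_ne {F E : Type*} [Field F] [Field E] [Algebra F E]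
    {f : F[X]} (hirr : Irreducible f) {ζ : E} (hζ : aeval ζ f = 0) {p : ℕ} (hp : p.Prime)
    (h : ∀ η ∈ IntermediateField.adjoin F {ζ}, η ^ p ≠ ζ) :
    Irreducible (expand F p f) := by
  have hc : IsUnit (C f.leadingCoeff⁻¹) :=
    isUnit_C.2 (inv_ne_zero (leadingCoeff_ne_zero.2 hirr.ne_zero)).isUnit
  have hmonic : (f * C f.leadingCoeff⁻¹).Monic := monic_mul_leadingCoeff_inv hirr.ne_zero
  have hirr' : Irreducible (f * C f.leadingCoeff⁻¹) := irreducible_mul_leadingCoeff_inv.2 hirr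
  rw [← irreducible_mul_isUnit hc, ← expand_C p, ← map_mul, expand_eq_comp_X_pow]
  refine irreducible_comp hmonic (monic_X_pow p) hirr' fun K _ _ x hx ↦ ?_
  have hmin : minpoly F x = minpoly F ζ := hx.trans (minpoly.eq_of_irreducible hirr hζ)
  have hxint : IsIntegral F x := minpoly.ne_zero_iff.1 (hx ▸ hirr'.ne_zero)
  have hζint : IsIntegral F ζ := minpoly.ne_zero_iff.1 (hmin ▸ hx ▸ hirr'.ne_zero)
  rw [Polynomial.map_pow, map_X]
  refine X_pow_sub_C_irreducible_of_prime hp fun b hb ↦ ?_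
  let φ := (IntermediateField.adjoinRootEquivAdjoin F hxint).symm.trans
    ((AdjoinRoot.algEquivOfEq F _ _ hmin).trans
      (IntermediateField.adjoinRootEquivAdjoin F hζint))
  have hφ : φ (IntermediateField.AdjoinSimple.gen F x) =
      IntermediateField.AdjoinSimple.gen F ζ := by
    rw [AlgEquiv.trans_apply, AlgEquiv.trans_apply,
      IntermediateField.adjoinRootEquivAdjoin_symm_apply_gen, AdjoinRoot.algEquivOfEq_root,
      IntermediateField.adjoinRootEquivAdjoin_apply_root]
  refine h (φ b) (φ b).2 ?_
  have := congrArg φ hb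
  rw [map_pow, hφ] at this
  simpa using congrArg (algebraMap _ E) this

/-- Let `F ⊆ ℂ` be a subfield, `f ∈ F[t]` irreducible with root `ζ ∈ ℂ`, and `p` a prime such
that `f(t^p)` is reducible over `F`.  Then some `η ∈ F(ζ)` satisfies `η^p = ζ`; moreover if `f`
is monic with algebraic-integer coefficients then `η` is an algebraic integer. -/
theorem exists_pth_root_in_adjoin
    (F : Subfield ℂ) (f : Polynomial F) (hirr : Irreducible f)
    (ζ : ℂ) (hζ : Polynomial.aeval ζ f = 0)
    (p : ℕ) (hp : p.Prime)
    (hred : ¬ Irreducible (Polynomial.expand F p f)) :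
    ∃ η ∈ IntermediateField.adjoin F {ζ}, η ^ p = ζ ∧
      ((f.Monic ∧ ∀ i : ℕ, IsIntegral ℤ (f.coeff i)) → IsIntegral ℤ η) := by
  by_contra! hne
  refine hred (irreducible_expand_of_forall_pow_ne hirr hζ hp fun η hη hηp ↦ ?_)
  obtain ⟨⟨hmonic, hcoeff⟩, hηint⟩ := hne η hη hηp
  refine hηint (IsIntegral.of_pow hp.pos (hηp ▸ ?_))
  refine IsIntegral.of_aeval_monic_of_isIntegral_coeff (p := f.map (algebraMap F ℂ))
    (hmonic.map _) ?_ ?_ fun i ↦ ?_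
  · rw [natDegree_map]
    exact hirr.natDegree_pos.ne'
  · rw [eval_map_algebraMap, hζ]
    exact isIntegral_zero
  · rw [coeff_map]
    exact (hcoeff i).algebraMap
end

section
/- Let F be a subfield of ℂ, let f ∈ F[t] be irreducible of degree n with f(ζ) = 0 for some ζ ∈ ℂ, let p be a prime such that f(t^p) is reducible over F, and let ξ ∈ ℂ satisfy ξ^p = ζ. Then the degree of the field extension [F(ξ) : F(ζ)] is strictly less than p. -/
open Polynomial

/-- Let `F ⊆ ℂ` be a subfield, `f ∈ F[t]` irreducible with root `ζ ∈ ℂ`, let `p` be a prime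
such that `f(t^p)` is reducible over `F`, and let `ξ ∈ ℂ` satisfy `ξ^p = ζ`.  Then
`[F(ξ) : F(ζ)] < p`.  Since `ζ = ξ^p ∈ F(ξ)`, the field `F(ξ)` coincides with `F(ζ)(ξ)`,
so the degree is expressed as `[F(ζ)(ξ) : F(ζ)]`. -/
theorem finrank_adjoin_pth_root_lt
    (F : Subfield ℂ) (f : Polynomial F) (hirr : Irreducible f)
    (ζ : ℂ) (hζ : Polynomial.aeval ζ f = 0)
    (p : ℕ) (hp : p.Prime)
    (hred : ¬ Irreducible (Polynomial.expand F p f))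
    (ξ : ℂ) (hξ : ξ ^ p = ζ) :
    Module.finrank (IntermediateField.adjoin F {ζ})
      (IntermediateField.adjoin (IntermediateField.adjoin F {ζ}) {ξ}) < p := by
  have hroot : aeval ξ (expand F p f) = 0 := by rw [expand_aeval, hξ, hζ]
  have hne : expand F p f ≠ 0 := (expand_ne_zero hp.pos).2 hirr.ne_zero
  have hintξ : IsIntegral F ξ := IsAlgebraic.isIntegral ⟨_, hne, hroot⟩
  have hintζ : IsIntegral F ζ := IsAlgebraic.isIntegral ⟨_, hirr.ne_zero, hζ⟩
  have hfield : (IntermediateField.adjoin (IntermediateField.adjoin F {ζ}) {ξ}).restrictScalars F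
      = IntermediateField.adjoin F {ξ} := by
    rw [IntermediateField.adjoin_adjoin_left]
    apply le_antisymm
    · rw [IntermediateField.adjoin_le_iff]
      rintro x (rfl | rfl)
      · rw [← hξ]
        exact pow_mem (IntermediateField.mem_adjoin_simple_self F ξ) p
      · exact IntermediateField.mem_adjoin_simple_self F x
    · exact IntermediateField.adjoin.mono _ _ _ Set.subset_union_right
  have htower := Module.finrank_mul_finrank F (IntermediateField.adjoin F {ζ})
    (IntermediateField.adjoin (IntermediateField.adjoin F {ζ}) {ξ})
  have htop : Module.finrank F (IntermediateField.adjoin (IntermediateField.adjoin F {ζ}) {ξ})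
      = (minpoly F ξ).natDegree := by
    rw [← IntermediateField.adjoin.finrank hintξ, ← hfield]
    rfl
  have hbot : (minpoly F ζ).natDegree = f.natDegree := by
    rw [← minpoly.eq_of_irreducible hirr hζ,
      natDegree_mul_C (inv_ne_zero (leadingCoeff_ne_zero.2 hirr.ne_zero))]
  rw [htop, IntermediateField.adjoin.finrank hintζ, hbot] at htower
  by_contra! hle
  refine hred ((associated_of_dvd_of_natDegree_le (minpoly.dvd F ξ hroot) hne ?_).irreducible
    (minpoly.irreducible hintξ))
  rw [natDegree_expand, ← htower]
  exact Nat.mul_le_mul_left _ hle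
end

section
/- Let K be a number field and let ζ be a nonzero element of the ring of integers 𝒪_K such that ζ^n ≠ 1 for all integers n > 0 (ζ is not a root of unity). Then the set of prime numbers p for which there exists η ∈ 𝒪_K with η^p = ζ is finite. -/
open NumberField in
/-- The house of an algebraic integer bounds every conjugate of each of its roots. -/
lemma norm_embedding_le_house_pow {K : Type*} [Field K] [NumberField K] {x : K}
    (hx : IsIntegral ℤ x) (hx0 : x ≠ 0) {n : ℕ} (hn : n ≠ 0) (φ : K →+* ℂ) :
    ‖φ x‖ ≤ house (x ^ n) := by
  have hle : ‖φ x‖ ^ n ≤ house (x ^ n) := by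
    simpa using norm_embedding_le_house (x ^ n) φ
  rcases le_total ‖φ x‖ 1 with h | h
  · exact h.trans (one_le_house_of_isIntegral (hx.pow n) (pow_ne_zero n hx0))
  · exact (le_self_pow₀ h hn).trans hle

/-- A nonzero algebraic integer of a number field has only finitely many roots, of any positive
degree, among the algebraic integers of the field. -/
lemma finite_setOf_exists_pow_eq_ringOfIntegers {K : Type*} [Field K] [NumberField K]
    {ζ : NumberField.RingOfIntegers K} (hζ : ζ ≠ 0) :
    {η : NumberField.RingOfIntegers K | ∃ n : ℕ, n ≠ 0 ∧ η ^ n = ζ}.Finite := by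
  refine ((NumberField.Embeddings.finite_of_norm_le K ℂ
    (NumberField.house (ζ : K))).preimage
    NumberField.RingOfIntegers.coe_injective.injOn).subset ?_
  rintro η ⟨n, hn, rfl⟩
  refine ⟨η.isIntegral_coe, fun φ ↦ ?_⟩
  have hη : (η : K) ≠ 0 :=
    NumberField.RingOfIntegers.coe_ne_zero_iff.mpr (ne_zero_pow hn hζ)
  simpa using norm_embedding_le_house_pow η.isIntegral_coe hη hn φ

/-- If `x ^ m` is not zero and not a root of unity, the exponent `m` is determined by `x ^ m`. -/
lemma eq_of_pow_eq_pow_of_forall_pow_ne_one {M : Type*} [CommMonoidWithZero M]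
    [IsCancelMulZero M] {x : M} {m n : ℕ} (h0 : x ^ m ≠ 0)
    (hx : ∀ k : ℕ, 0 < k → (x ^ m) ^ k ≠ 1) (h : x ^ n = x ^ m) : n = m := by
  have key : ∀ a d : ℕ, x ^ a ≠ 0 → x ^ (a + d) = x ^ a → d = 0 := by
    intro a d ha had
    by_contra hd
    have h1 : x ^ d = 1 := mul_left_cancel₀ ha (by rw [← pow_add, had, mul_one])
    exact hx d (Nat.pos_of_ne_zero hd) (by rw [← pow_mul, mul_comm, pow_mul, h1, one_pow])
  rcases le_total m n with hmn | hnm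
  · obtain ⟨d, rfl⟩ := Nat.exists_eq_add_of_le hmn
    rw [key m d h0 h, add_zero]
  · obtain ⟨d, rfl⟩ := Nat.exists_eq_add_of_le hnm
    rw [key n d (h ▸ h0) h.symm, add_zero]

/-- Let `K` be a number field and `ζ` a nonzero algebraic integer of `K` that is not a root of
unity.  Then the set of primes `p` such that `ζ` has a `p`-th root in `𝒪_K` is finite. -/
theorem finite_primes_pth_root_ringOfIntegers
    (K : Type*) [Field K] [NumberField K]
    (ζ : NumberField.RingOfIntegers K) (hζ0 : ζ ≠ 0)
    (hru : ∀ n : ℕ, 0 < n → ζ ^ n ≠ 1) :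
    {p : ℕ | p.Prime ∧ ∃ η : NumberField.RingOfIntegers K, η ^ p = ζ}.Finite := by
  refine ((finite_setOf_exists_pow_eq_ringOfIntegers hζ0).biUnion
    (t := fun η ↦ {p : ℕ | η ^ p = ζ}) fun η _ ↦ Set.Subsingleton.finite ?_).subset ?_
  · rintro p hp q rfl
    exact eq_of_pow_eq_pow_of_forall_pow_ne_one hζ0 hru hp
  · rintro p ⟨hp, η, hη⟩
    exact Set.mem_biUnion (show _ ∈ {η | ∃ n : ℕ, n ≠ 0 ∧ η ^ n = ζ} from ⟨p, hp.ne_zero, hη⟩) hη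
end

section
/- Let G be a finitely generated commutative group and let x ∈ G be an element of infinite order. Then the set of prime numbers p for which there exists y ∈ G with y^p = x is finite. -/
/-- In a finitely generated commutative group, an element of infinite order is detected by some
homomorphism to the infinite cyclic group. -/
theorem CommGroup.exists_monoidHom_multiplicative_int_ne_one
    {G : Type*} [CommGroup G] [Group.FG G] {x : G} (hx : ∀ n : ℕ, 0 < n → x ^ n ≠ 1) :
    ∃ f : G →* Multiplicative ℤ, f x ≠ 1 := by
  obtain ⟨ι, j, _, _, p, hp, e, ⟨φ⟩⟩ := CommGroup.equiv_free_prod_prod_multiplicative_zmod G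
  have (i : ι) : NeZero (p i ^ e i) := ⟨pow_ne_zero _ (hp i).ne_zero⟩
  have (i : ι) : Finite (Multiplicative (ZMod (p i ^ e i))) :=
    inferInstanceAs (Finite (ZMod (p i ^ e i)))
  by_contra! h
  have h_free : (φ x).1 = 1 := by
    funext i
    exact h (((Pi.evalMonoidHom _ i).comp (MonoidHom.fst _ _)).comp φ.toMonoidHom)
  refine hx _ (orderOf_pos (φ x).2) (φ.injective ?_)
  rw [map_pow, map_one]
  exact Prod.ext (by simp [h_free]) (by simp [pow_orderOf_eq_one])

/-- Let `G` be a finitely generated commutative group and `x ∈ G` an element of infinite order.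
Then the set of primes `p` for which `x` has a `p`-th root in `G` is finite. -/
theorem finite_primes_pth_root_of_infinite_order
    (G : Type*) [CommGroup G] [Group.FG G]
    (x : G) (hx : ∀ n : ℕ, 0 < n → x ^ n ≠ 1) :
    {p : ℕ | p.Prime ∧ ∃ y : G, y ^ p = x}.Finite := by
  obtain ⟨f, hf⟩ := CommGroup.exists_monoidHom_multiplicative_int_ne_one hx
  have h_ne : (f x).toAdd.natAbs ≠ 0 := fun h => hf (Int.natAbs_eq_zero.mp h)
  refine (Nat.divisors (f x).toAdd.natAbs).finite_toSet.subset ?_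
  rintro p ⟨-, y, rfl⟩
  refine Nat.mem_divisors.mpr ⟨?_, h_ne⟩
  simp [Int.natAbs_mul]
end

section
/- The polynomial Δ₃(t) is irreducible in ℚ(ω)[t], where ω is a primitive 13th root of unity. -/
open Polynomial

/-- The coefficient `c₁` of the twisted Alexander polynomial `Δ₃` of `8₁₇`. -/
noncomputable def c₁ (ω : CyclotomicField 13 ℚ) : CyclotomicField 13 ℚ :=
  2 * ω + 2 * ω ^ 2 + 2 * ω ^ 3 + 4 * ω ^ 4 + 2 * ω ^ 5 + 2 * ω ^ 6 + ω ^ 7 + ω ^ 8 +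
    2 * ω ^ 9 + 4 * ω ^ 10 + ω ^ 11 + 4 * ω ^ 12

/-- The coefficient `c₂` of the twisted Alexander polynomial `Δ₃` of `8₁₇`. -/
noncomputable def c₂ (ω : CyclotomicField 13 ℚ) : CyclotomicField 13 ℚ :=
  -15 * ω - 10 * ω ^ 2 - 15 * ω ^ 3 - 15 * ω ^ 4 - 10 * ω ^ 5 - 10 * ω ^ 6 - 10 * ω ^ 7 -
    10 * ω ^ 8 - 15 * ω ^ 9 - 15 * ω ^ 10 - 10 * ω ^ 11 - 15 * ω ^ 12

/-- The coefficient `c₃` of the twisted Alexander polynomial `Δ₃` of `8₁₇`. -/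
noncomputable def c₃ (ω : CyclotomicField 13 ℚ) : CyclotomicField 13 ℚ :=
  4 * ω + ω ^ 2 + 4 * ω ^ 3 + 2 * ω ^ 4 + ω ^ 5 + ω ^ 6 + 2 * ω ^ 7 + 2 * ω ^ 8 +
    4 * ω ^ 9 + 2 * ω ^ 10 + 2 * ω ^ 11 + 2 * ω ^ 12

/-- The twisted Alexander polynomial `Δ₃(t)` of `8₁₇` (with the factor `1 - t` removed). -/
noncomputable def Δ₃ (ω : CyclotomicField 13 ℚ) : Polynomial (CyclotomicField 13 ℚ) :=
  C 1 + C (c₁ ω) * X + C (c₂ ω) * X ^ 2 + C (c₃ ω) * X ^ 3 + X ^ 4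

/-- The coefficient `d₁` of the twisted Alexander polynomial `Δ₉` of `8₁₇`. -/
noncomputable def d₁ (ω : CyclotomicField 13 ℚ) : CyclotomicField 13 ℚ :=
  6 * ω + 5 * ω ^ 2 + 6 * ω ^ 3 + 6 * ω ^ 4 + 5 * ω ^ 5 + 5 * ω ^ 6 + 5 * ω ^ 7 +
    5 * ω ^ 8 + 6 * ω ^ 9 + 6 * ω ^ 10 + 5 * ω ^ 11 + 6 * ω ^ 12

/-- The coefficient `d₂` of the twisted Alexander polynomial `Δ₉` of `8₁₇`. -/
noncomputable def d₂ (ω : CyclotomicField 13 ℚ) : CyclotomicField 13 ℚ :=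
  -13 * ω - 12 * ω ^ 2 - 13 * ω ^ 3 - 13 * ω ^ 4 - 12 * ω ^ 5 - 12 * ω ^ 6 - 12 * ω ^ 7 -
    12 * ω ^ 8 - 13 * ω ^ 9 - 13 * ω ^ 10 - 12 * ω ^ 11 - 13 * ω ^ 12

/-- The twisted Alexander polynomial `Δ₉(t)` of `8₁₇` (with the factor `1 - t` removed). -/
noncomputable def Δ₉ (ω : CyclotomicField 13 ℚ) : Polynomial (CyclotomicField 13 ℚ) :=
  C 1 + C (d₁ ω) * X + C (d₂ ω) * X ^ 2 + C (d₁ ω) * X ^ 3 + X ^ 4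

/-- A monic quartic over a field with no root and no factorization into two monic quadratics
is irreducible. -/
theorem irreducible_quartic {F : Type*} [Field F] (d a b c : F)
    (hroot : ∀ x, d + a * x + b * x ^ 2 + c * x ^ 3 + x ^ 4 ≠ 0)
    (hquad : ∀ s u t v : F, s * t = d → s * v + u * t = a → s + u * v + t = b → u + v ≠ c) :
    Irreducible (C d + C a * X + C b * X ^ 2 + C c * X ^ 3 + X ^ 4 : F[X]) := by
  set p : F[X] := C d + C a * X + C b * X ^ 2 + C c * X ^ 3 + X ^ 4 with hp
  have hdeg : p.natDegree = 4 := by rw [hp]; compute_degree!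
  have hmonic : p.Monic := by rw [hp]; monicity!
  rw [hmonic.irreducible_iff_natDegree']
  refine ⟨fun h => by simp [h] at hdeg, fun f g hf hg hfg hmem => ?_⟩
  have hsum : f.natDegree + g.natDegree = 4 := by rw [← hf.natDegree_mul hg, hfg, hdeg]
  rw [hdeg, Finset.mem_Ioc] at hmem
  obtain hg1 | hg2 : g.natDegree = 1 ∨ g.natDegree = 2 := by omega
  · obtain ⟨x, hx⟩ := exists_root_of_degree_eq_one (degree_eq_iff_natDegree_eq hg.ne_zero |>.2 hg1)
    have hpx : p.eval x = 0 := by rw [← hfg, eval_mul, hx.eq_zero, mul_zero]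
    exact hroot x (by simpa [hp] using hpx)
  · have hf2 : f.natDegree = 2 := by omega
    have hf2' : f.coeff 2 = 1 := by rw [← hf2]; exact hf
    have hg2' : g.coeff 2 = 1 := by rw [← hg2]; exact hg
    have hf3 : f.coeff 3 = 0 := coeff_eq_zero_of_natDegree_lt (by omega)
    have hg3 : g.coeff 3 = 0 := coeff_eq_zero_of_natDegree_lt (by omega)
    have key (n : ℕ) : (f * g).coeff n = p.coeff n := by rw [hfg]
    have h0 := key 0
    have h1 := key 1
    have h2 := key 2
    have h3 := key 3
    simp [coeff_mul, Finset.Nat.antidiagonal_succ, hp, coeff_X, coeff_C, hf2', hg2', hf3, hg3]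
      at h0 h1 h2 h3
    exact hquad (f.coeff 0) (f.coeff 1) (g.coeff 0) (g.coeff 1) h0 (by linear_combination h1)
      (by linear_combination h2) (by linear_combination h3)

instance fact_prime_131 : Fact (Nat.Prime 131) := ⟨by norm_num⟩

/-- If a monic quartic with constant term `1` is a product of two monic quadratics with constant
terms `s` and `t`, then `s + t` is a root of its resolvent cubic. -/
theorem resolvent_of_mul_eq_one {R : Type*} [CommRing R] {a b c s u t v : R} (h0 : s * t = 1)
    (h1 : s * v + u * t = a) (h2 : s + u * v + t = b) (h3 : u + v = c) :
    a * (c * (s + t) - a) = c ^ 2 + (b - (s + t)) * ((s + t) ^ 2 - 4) := by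
  subst h1 h2 h3
  linear_combination (u - v) ^ 2 * h0

/-- The reduction of `Δ₃` at the prime of `ℚ(ω)` above `131` containing `ω - 45` is irreducible. -/
theorem irreducible_reduction_Δ₃ :
    Irreducible (C 1 + C 78 * X + C 108 * X ^ 2 + C 96 * X ^ 3 + X ^ 4 : (ZMod 131)[X]) := by
  apply irreducible_quartic
  · decide +kernel
  · intro s u t v h0 h1 h2 h3
    have hroot : ∀ w : ZMod 131,
        78 * (96 * w - 78) = 96 ^ 2 + (108 - w) * (w ^ 2 - 4) → w = 99 := by
      decide +kernel
    have hw : s + t = 99 := hroot _ (resolvent_of_mul_eq_one h0 h1 h2 h3)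
    have hs : ∀ s : ZMod 131, s * (99 - s) ≠ 1 := by decide +kernel
    exact hs s (by rw [← hw, add_sub_cancel_left, h0])

/-- A ring homomorphism from the ring of integers of the `n`-th cyclotomic field can be prescribed
on a primitive `n`-th root of unity by any root of the `n`-th cyclotomic polynomial. -/
theorem exists_ringHom_ringOfIntegers {K R : Type*} [Field K] [NumberField K] [CommRing R]
    {n : ℕ} [NeZero n] [IsCyclotomicExtension {n} ℚ K] {ζ : K} (hζ : IsPrimitiveRoot ζ n) {y : R}
    (hy : (cyclotomic n R).eval y = 0) :
    ∃ φ : NumberField.RingOfIntegers K →+* R, φ hζ.toInteger = y := by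
  have hmin : aeval y (minpoly ℤ hζ.integralPowerBasis.gen) = 0 := by
    rw [hζ.integralPowerBasis_gen, ← NumberField.RingOfIntegers.minpoly_coe]
    change aeval y (minpoly ℤ ζ) = 0
    rw [← cyclotomic_eq_minpoly hζ (NeZero.pos n), aeval_def, eval₂_eq_eval_map, map_cyclotomic, hy]
  refine ⟨(hζ.integralPowerBasis.lift y hmin).toRingHom, ?_⟩
  have h := hζ.integralPowerBasis.lift_gen y hmin
  rwa [hζ.integralPowerBasis_gen] at h

/-- The twisted Alexander polynomial `Δ₃(t)` of `8₁₇` is irreducible in `ℚ(ω)[t]`, where `ω`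
is a primitive 13th root of unity. -/
theorem Δ₃_irreducible (ω : CyclotomicField 13 ℚ) (hω : IsPrimitiveRoot ω 13) :
    Irreducible (Δ₃ ω) := by
  have hcyc : (cyclotomic 13 (ZMod 131)).eval 45 = 0 := by
    have : Fact (Nat.Prime 13) := ⟨by norm_num⟩
    rw [cyclotomic_prime, eval_geom_sum]
    decide +kernel
  have : NeZero ((13 : ℕ) : ℚ) := ⟨by norm_num⟩
  have : IsCyclotomicExtension {13} ℚ (CyclotomicField 13 ℚ) :=
    CyclotomicField.isCyclotomicExtension 13 ℚ
  obtain ⟨φ, hφ⟩ := exists_ringHom_ringOfIntegers hω hcyc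
  set z := hω.toInteger
  have hz : algebraMap _ (CyclotomicField 13 ℚ) z = ω := rfl
  let e₁ : NumberField.RingOfIntegers (CyclotomicField 13 ℚ) :=
    2 * z + 2 * z ^ 2 + 2 * z ^ 3 + 4 * z ^ 4 + 2 * z ^ 5 + 2 * z ^ 6 + z ^ 7 + z ^ 8 +
      2 * z ^ 9 + 4 * z ^ 10 + z ^ 11 + 4 * z ^ 12
  let e₂ : NumberField.RingOfIntegers (CyclotomicField 13 ℚ) :=
    -15 * z - 10 * z ^ 2 - 15 * z ^ 3 - 15 * z ^ 4 - 10 * z ^ 5 - 10 * z ^ 6 - 10 * z ^ 7 -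
      10 * z ^ 8 - 15 * z ^ 9 - 15 * z ^ 10 - 10 * z ^ 11 - 15 * z ^ 12
  let e₃ : NumberField.RingOfIntegers (CyclotomicField 13 ℚ) :=
    4 * z + z ^ 2 + 4 * z ^ 3 + 2 * z ^ 4 + z ^ 5 + z ^ 6 + 2 * z ^ 7 + 2 * z ^ 8 +
      4 * z ^ 9 + 2 * z ^ 10 + 2 * z ^ 11 + 2 * z ^ 12
  let q : (NumberField.RingOfIntegers (CyclotomicField 13 ℚ))[X] :=
    C 1 + C e₁ * X + C e₂ * X ^ 2 + C e₃ * X ^ 3 + X ^ 4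
  have hq : q.Monic := by simp only [q]; monicity!
  have hmap : q.map (algebraMap _ (CyclotomicField 13 ℚ)) = Δ₃ ω := by
    have hnum (n : ℕ) [n.AtLeastTwo] : algebraMap
        (NumberField.RingOfIntegers (CyclotomicField 13 ℚ)) (CyclotomicField 13 ℚ) ofNat(n) =
        ofNat(n) := map_ofNat (algebraMap _ _) n
    simp [q, Δ₃, c₁, c₂, c₃, e₁, e₂, e₃, hz, hnum]
  have h₁ : φ e₁ = 78 := by
    simp only [e₁, map_add, map_mul, map_pow, map_ofNat, hφ]
    decide +kernel
  have h₂ : φ e₂ = 108 := by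
    simp only [e₂, map_sub, map_neg, map_mul, map_pow, map_ofNat, hφ]
    decide +kernel
  have h₃ : φ e₃ = 96 := by
    simp only [e₃, map_add, map_mul, map_pow, map_ofNat, hφ]
    decide +kernel
  have hred : q.map φ = C 1 + C 78 * X + C 108 * X ^ 2 + C 96 * X ^ 3 + X ^ 4 := by
    simp only [q, Polynomial.map_add, Polynomial.map_mul, Polynomial.map_pow, map_C, map_X,
      Polynomial.map_one, _root_.map_one, h₁, h₂, h₃]
  rw [← hmap, ← hq.irreducible_iff_irreducible_map_fraction_map]
  exact hq.irreducible_of_irreducible_map φ q (hred ▸ irreducible_reduction_Δ₃)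
end

section
/- The polynomials Δ₃(t) and Δ₉(t) are not Galois conjugate over ℚ: for every field automorphism σ of ℚ(ω) (where ω is a primitive 13th root of unity), the polynomial obtained by applying σ to every coefficient of Δ₃(t) is not equal to Δ₉(t). -/
open Polynomial

/-- The sum of the primitive 13th roots of unity is `-1`, with the quadratic residues separated from
the nonresidues. -/
theorem IsPrimitiveRoot.sum_thirteen {R : Type*} [CommRing R] [IsDomain R] {ω : R}
    (hω : IsPrimitiveRoot ω 13) :
    (ω + ω ^ 3 + ω ^ 4 + ω ^ 9 + ω ^ 10 + ω ^ 12) +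
      (ω ^ 2 + ω ^ 5 + ω ^ 6 + ω ^ 7 + ω ^ 8 + ω ^ 11) = -1 := by
  have h := hω.geom_sum_eq_zero (by norm_num)
  simp only [Finset.sum_range_succ, Finset.sum_range_zero] at h
  linear_combination h

/-- The quadratic Gaussian period of a primitive 13th root of unity is a root of `x² + x - 3`. -/
theorem IsPrimitiveRoot.sq_gaussianPeriod_thirteen {R : Type*} [CommRing R] [IsDomain R] {ω : R}
    (hω : IsPrimitiveRoot ω 13) :
    (ω + ω ^ 3 + ω ^ 4 + ω ^ 9 + ω ^ 10 + ω ^ 12) ^ 2 +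
      (ω + ω ^ 3 + ω ^ 4 + ω ^ 9 + ω ^ 10 + ω ^ 12) - 3 = 0 := by
  have h := hω.sum_thirteen
  have h13 := hω.pow_eq_one
  grind

/-- The polynomials `Δ₃(t)` and `Δ₉(t)` are not Galois conjugate over `ℚ`: no `ℚ`-algebra
automorphism of `ℚ(ω)` carries the coefficients of `Δ₃` to those of `Δ₉`. -/
theorem Δ₃_Δ₉_not_galois_conjugate (ω : CyclotomicField 13 ℚ) (hω : IsPrimitiveRoot ω 13)
    (σ : CyclotomicField 13 ℚ ≃ₐ[ℚ] CyclotomicField 13 ℚ) :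
    Polynomial.map (σ : CyclotomicField 13 ℚ →+* CyclotomicField 13 ℚ) (Δ₃ ω) ≠ Δ₉ ω := by
  intro h
  have hcoeff : σ (c₂ ω) = d₂ ω := by
    simpa [Δ₃, Δ₉, coeff_X, coeff_X_pow, coeff_one] using congrArg (fun p => p.coeff 2) h
  have hsum := hω.sum_thirteen
  have hsq := hω.sq_gaussianPeriod_thirteen
  set a := ω + ω ^ 3 + ω ^ 4 + ω ^ 9 + ω ^ 10 + ω ^ 12 with ha
  have hc : c₂ ω = 10 - 5 * a := by
    rw [c₂, ha]
    linear_combination -10 * hsum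
  have hd : d₂ ω = 12 - a := by
    rw [d₂, ha]
    linear_combination -12 * hsum
  have hσsq : σ a ^ 2 + σ a - 3 = 0 := by
    simpa [map_ofNat σ] using congrArg σ hsq
  have hσ : 10 - 5 * σ a = 12 - a := by simpa [hc, hd, map_ofNat σ] using hcoeff
  have h78 : (78 : CyclotomicField 13 ℚ) = 0 := by
    linear_combination hsq - 25 * hσsq - (a + 5 * σ a + 3) * hσ
  norm_num at h78
end

section
/- Let K be a field equipped with a ring involution c : K → K (an automorphism with c ∘ c = id). For a polynomial f ∈ K[X] with f(0) ≠ 0, let f* denote the polynomial obtained by reversing the coefficients of f and applying c to each coefficient. If P ∈ K[X] satisfies P = u · f · f* for some nonzero constant u ∈ K and some f ∈ K[X] with f(0) ≠ 0, then for every irreducible polynomial q ∈ K[X] with q(0) ≠ 0, the multiplicity of q as a factor of P equals the multiplicity of q* as a factor of P. -/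
open Polynomial

namespace Polynomial

lemma reverse_reverse_of_coeff_zero_ne_zero {R : Type*} [Semiring R] {f : R[X]}
    (hf : f.coeff 0 ≠ 0) : f.reverse.reverse = f := by
  have h : f.reverse.natDegree = f.natDegree := by
    rw [reverse_natDegree, natTrailingDegree_eq_zero_of_constantCoeff_ne_zero hf, Nat.sub_zero]
  ext n
  rw [coeff_reverse, coeff_reverse, h, revAt_invol]

lemma reverse_map_of_injective {R S : Type*} [Semiring R] [Semiring S] {φ : R →+* S}
    (hφ : Function.Injective φ) (f : R[X]) : (f.map φ).reverse = f.reverse.map φ := by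
  ext n
  rw [coeff_reverse, coeff_map, coeff_map, coeff_reverse, natDegree_map_eq_of_injective hφ]

lemma reverse_map_reverse_map {K : Type*} [Field K] {c : K ≃+* K} (hc : ∀ x, c (c x) = x)
    {f : K[X]} (hf : f.coeff 0 ≠ 0) :
    (f.reverse.map (c : K →+* K)).reverse.map (c : K →+* K) = f := by
  rw [reverse_map_of_injective c.injective, reverse_reverse_of_coeff_zero_ne_zero hf]
  ext n
  simp [hc]

lemma reverse_map_dvd_reverse_map {K : Type*} [Field K] (φ : K →+* K) {f g : K[X]}
    (h : f ∣ g) : f.reverse.map φ ∣ g.reverse.map φ := by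
  obtain ⟨r, rfl⟩ := h
  rw [reverse_mul_of_domain, Polynomial.map_mul]
  exact dvd_mul_right _ _

lemma reverse_map_pow {K : Type*} [Field K] (φ : K →+* K) (f : K[X]) (n : ℕ) :
    (f ^ n).reverse.map φ = f.reverse.map φ ^ n := by
  induction n with
  | zero => rw [pow_zero, pow_zero, ← C_1, reverse_C, map_C, map_one]
  | succ n ih => rw [pow_succ, reverse_mul_of_domain, Polynomial.map_mul, ih, pow_succ]

end Polynomial

/-- Let `K` be a field with a ring involution `c`.  For `f ∈ K[X]` with `f(0) ≠ 0`, write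
`f*` for the coefficientwise image under `c` of the reverse of `f`.  If `P = u · f · f*` for
some nonzero constant `u` and some `f` with `f(0) ≠ 0`, then for every irreducible `q ∈ K[X]`
with `q(0) ≠ 0`, the multiplicity of `q` in `P` equals the multiplicity of `q*` in `P`. -/
theorem multiplicity_eq_multiplicity_star_of_norm
    (K : Type*) [Field K] (c : K ≃+* K) (hc : ∀ x : K, c (c x) = x)
    (P f : Polynomial K) (u : K) (hu : u ≠ 0) (hf0 : f.coeff 0 ≠ 0)
    (hP : P = C u * f * (f.reverse.map (c : K →+* K)))
    (q : Polynomial K) (hq : Irreducible q) (hq0 : q.coeff 0 ≠ 0) :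
    multiplicity q P = multiplicity (q.reverse.map (c : K →+* K)) P := by
  have hPstar : P.reverse.map (c : K →+* K) ∣ P := by
    have hcu : IsUnit (C (c u)) := isUnit_C.2 (by simpa using hu)
    have h : P.reverse.map (c : K →+* K) = C (c u) * (f * f.reverse.map (c : K →+* K)) := by
      rw [hP, reverse_mul_of_domain, reverse_mul_of_domain, Polynomial.map_mul,
        Polynomial.map_mul, reverse_map_reverse_map hc hf0, reverse_C, map_C]
      simp only [RingHom.coe_coe]
      ring
    rw [h, hcu.mul_left_dvd, hP, mul_assoc]
    exact dvd_mul_left _ _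
  have key : ∀ {r : K[X]} {n : ℕ}, r ^ n ∣ P → r.reverse.map (c : K →+* K) ^ n ∣ P := by
    intro r n h
    rw [← reverse_map_pow]
    exact (reverse_map_dvd_reverse_map _ h).trans hPstar
  refine multiplicity_eq_of_emultiplicity_eq (emultiplicity_eq_emultiplicity_iff.2 fun n => ?_)
  refine ⟨key, fun h => ?_⟩
  simpa only [reverse_map_reverse_map hc hq0] using key h
end

section
/- For all ℚ-algebra automorphisms σ_a, σ_b, σ_c, σ_d of ℚ(ω), any product of the form σ_a(Δ₃(t^α))^x · σ_b(Δ₉(t^α))^y · σ_c(Δ₃(t^β))^z · σ_d(Δ₉(t^β))^w, where α ≠ β are primes with all four expanded polynomials Δ₃(t^α), Δ₉(t^α), Δ₃(t^β), Δ₉(t^β) irreducible over ℚ(ω), and exactly one of x, y, z, w equals 1 and the rest are 0, cannot be written in the form u · t^k · (1−t)^j · f(t) · f*(t) for any nonzero u ∈ ℚ(ω), integers j, k ≥ 0, and f ∈ ℚ(ω)[t] with f(0) ≠ 0, where f* is the coefficientwise complex-conjugate (ω ↦ ω⁻¹) of the reverse of f. -/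
open Polynomial

/-- A divisor of an irreducible polynomial over a field is constant or has full degree. -/
theorem Irreducible.natDegree_eq_zero_or_eq_of_dvd {K : Type*} [Field K] {p q : K[X]}
    (hp : Irreducible p) (hq : q ∣ p) : q.natDegree = 0 ∨ q.natDegree = p.natDegree := by
  obtain ⟨r, rfl⟩ := hq
  obtain ⟨hq0, hr0⟩ := mul_ne_zero_iff.mp hp.ne_zero
  rcases hp.isUnit_or_isUnit rfl with h | h
  · exact .inl (natDegree_eq_zero_of_isUnit h)
  · right
    rw [natDegree_mul hq0 hr0, natDegree_eq_zero_of_isUnit h, add_zero]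

/-- Reversing a polynomial with nonzero constant term and applying a field homomorphism to its
coefficients preserves the degree. -/
theorem Polynomial.natDegree_map_reverse {K L : Type*} [Field K] [Field L] (τ : K →+* L)
    {f : K[X]} (hf : f.coeff 0 ≠ 0) : (f.reverse.map τ).natDegree = f.natDegree := by
  rw [natDegree_map, reverse_natDegree, natTrailingDegree_eq_zero.mpr (.inr hf), Nat.sub_zero]

/-- An irreducible polynomial of degree at least two is not a norm up to units, powers of `X`
and powers of `1 - X`. -/
theorem Irreducible.ne_norm {K : Type*} [Field K] {p : K[X]} (hp : Irreducible p)
    (hdeg : 2 ≤ p.natDegree) (τ : K →+* K) (u : K) (j k : ℕ) {f : K[X]} (hf : f.coeff 0 ≠ 0) :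
    p ≠ C u * X ^ k * (1 - X) ^ j * f * f.reverse.map τ := by
  intro h
  have hrev := natDegree_map_reverse τ hf
  have hk : k = 0 := by
    by_contra hk
    have hX : X ∣ p := h ▸
      ((((dvd_pow_self X hk).mul_left _).mul_right _).mul_right _).mul_right _
    have := hp.natDegree_eq_zero_or_eq_of_dvd hX
    rw [natDegree_X] at this
    omega
  have hj : j = 0 := by
    by_contra hj
    have hX : 1 - X ∣ p := h ▸ (((dvd_pow_self _ hj).mul_left _).mul_right _).mul_right _
    have := hp.natDegree_eq_zero_or_eq_of_dvd hX
    rw [show (1 - X : K[X]).natDegree = 1 by compute_degree!] at this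
    omega
  subst hk hj
  rw [pow_zero, pow_zero, mul_one, mul_one] at h
  have h0 : C u * f * f.reverse.map τ ≠ 0 := h ▸ hp.ne_zero
  obtain ⟨hl, hr⟩ := mul_ne_zero_iff.mp h0
  have hsum : p.natDegree = f.natDegree + f.natDegree := by
    rw [h, natDegree_mul hl hr, hrev, natDegree_C_mul]
    rintro rfl
    simp at hl
  have := hp.natDegree_eq_zero_or_eq_of_dvd (q := f) (h ▸ (dvd_mul_left _ _).mul_right _)
  omega

theorem natDegree_Δ₃ (ω : CyclotomicField 13 ℚ) : (Δ₃ ω).natDegree = 4 := by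
  unfold Δ₃
  compute_degree!

theorem natDegree_Δ₉ (ω : CyclotomicField 13 ℚ) : (Δ₉ ω).natDegree = 4 := by
  unfold Δ₉
  compute_degree!

/-- If the expansion by a prime of a quartic is irreducible, then none of its images under
automorphisms of the coefficient field is a norm up to units, powers of `X` and powers of
`1 - X`. -/
theorem map_expand_ne_norm {K : Type*} [Field K] [Algebra ℚ K] {α : ℕ} (hα : α.Prime) {p : K[X]}
    (hdeg : p.natDegree = 4) (hp : Irreducible (expand K α p)) (σ : K ≃ₐ[ℚ] K) (τ : K →+* K)
    (u : K) (j k : ℕ) {f : K[X]} (hf : f.coeff 0 ≠ 0) :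
    (expand K α p).map (σ : K →+* K) ≠ C u * X ^ k * (1 - X) ^ j * f * f.reverse.map τ := by
  refine Irreducible.ne_norm ?_ ?_ τ u j k hf
  · exact (MulEquiv.irreducible_iff (mapEquiv (σ : K ≃+* K))).mpr hp
  · rw [natDegree_map, natDegree_expand, hdeg]
    have := hα.two_le
    omega

/-- Suppose `α ≠ β` are primes such that the expanded polynomials `Δ₃(t^α)`, `Δ₉(t^α)`,
`Δ₃(t^β)`, `Δ₉(t^β)` are all irreducible over `ℚ(ω)`.  Then for all `ℚ`-algebra automorphisms
`σa, σb, σc, σd` of `ℚ(ω)` and exponents `x, y, z, w ∈ {0, 1}` exactly one of which is `1`,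
the product `σa(Δ₃(t^α))^x · σb(Δ₉(t^α))^y · σc(Δ₃(t^β))^z · σd(Δ₉(t^β))^w` cannot be
written as `u · t^k · (1-t)^j · f(t) · f*(t)` with `u ≠ 0`, `f(0) ≠ 0`, where `f*` is the
coefficientwise image, under the automorphism `τ` sending `ω` to `ω⁻¹`, of the reverse of
`f`; i.e. the product is not a norm modulo powers of `t` and `1 - t`. -/
theorem product_of_twisted_polynomials_not_norm
    (ω : CyclotomicField 13 ℚ) (hω : IsPrimitiveRoot ω 13)
    (τ : CyclotomicField 13 ℚ ≃ₐ[ℚ] CyclotomicField 13 ℚ) (hτ : τ ω = ω⁻¹)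
    (α β : ℕ) (hα : α.Prime) (hβ : β.Prime) (hαβ : α ≠ β)
    (h₁ : Irreducible (Polynomial.expand (CyclotomicField 13 ℚ) α (Δ₃ ω)))
    (h₂ : Irreducible (Polynomial.expand (CyclotomicField 13 ℚ) α (Δ₉ ω)))
    (h₃ : Irreducible (Polynomial.expand (CyclotomicField 13 ℚ) β (Δ₃ ω)))
    (h₄ : Irreducible (Polynomial.expand (CyclotomicField 13 ℚ) β (Δ₉ ω)))
    (σa σb σc σd : CyclotomicField 13 ℚ ≃ₐ[ℚ] CyclotomicField 13 ℚ)
    (x y z w : ℕ) (hxyzw : x + y + z + w = 1) :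
    ¬ ∃ (u : CyclotomicField 13 ℚ) (j k : ℕ) (f : Polynomial (CyclotomicField 13 ℚ)),
        u ≠ 0 ∧ f.coeff 0 ≠ 0 ∧
        (Polynomial.map (σa : CyclotomicField 13 ℚ →+* CyclotomicField 13 ℚ)
              (Polynomial.expand (CyclotomicField 13 ℚ) α (Δ₃ ω))) ^ x *
          (Polynomial.map (σb : CyclotomicField 13 ℚ →+* CyclotomicField 13 ℚ)
              (Polynomial.expand (CyclotomicField 13 ℚ) α (Δ₉ ω))) ^ y *
          (Polynomial.map (σc : CyclotomicField 13 ℚ →+* CyclotomicField 13 ℚ)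
              (Polynomial.expand (CyclotomicField 13 ℚ) β (Δ₃ ω))) ^ z *
          (Polynomial.map (σd : CyclotomicField 13 ℚ →+* CyclotomicField 13 ℚ)
              (Polynomial.expand (CyclotomicField 13 ℚ) β (Δ₉ ω))) ^ w =
        C u * X ^ k * (1 - X) ^ j * f *
          (Polynomial.map (τ : CyclotomicField 13 ℚ →+* CyclotomicField 13 ℚ) f.reverse) := by
  rintro ⟨u, j, k, f, -, hf, h⟩
  have hcases : (x = 1 ∧ y = 0 ∧ z = 0 ∧ w = 0) ∨ (x = 0 ∧ y = 1 ∧ z = 0 ∧ w = 0) ∨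
      (x = 0 ∧ y = 0 ∧ z = 1 ∧ w = 0) ∨ (x = 0 ∧ y = 0 ∧ z = 0 ∧ w = 1) := by omega
  rcases hcases with ⟨rfl, rfl, rfl, rfl⟩ | ⟨rfl, rfl, rfl, rfl⟩ | ⟨rfl, rfl, rfl, rfl⟩ |
    ⟨rfl, rfl, rfl, rfl⟩ <;> simp only [pow_zero, pow_one, one_mul, mul_one] at h
  · exact map_expand_ne_norm hα (natDegree_Δ₃ ω) h₁ σa _ u j k hf h
  · exact map_expand_ne_norm hα (natDegree_Δ₉ ω) h₂ σb _ u j k hf h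
  · exact map_expand_ne_norm hβ (natDegree_Δ₃ ω) h₃ σc _ u j k hf h
  · exact map_expand_ne_norm hβ (natDegree_Δ₉ ω) h₄ σd _ u j k hf h
end
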